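/- arXiv:1905.03303 — 2 statements merged into one kernel-verified Lean document; each statement's English description precedes it below -/
import Mathlib

section
/- Let g ≥ 2 be an integer and let L, μ, V be real numbers with L > 0, L³ ≤ 2π², μ ≥ 0, and L² ≤ π/(g+1). If V ≤ L·√(4π(g−1) + μ) − μ/4 and L·√(4π(g−1) + μ) > 2π, then V < 0. -/
open Real

/-- for an integer `g ≥ 2` and reals `L > 0`, `L³ ≤ 2π²`, `μ ≥ 0`,
`L² ≤ π/(g+1)`, if `V ≤ L*√(4π(g-1)+μ) - μ/4` and `L*√(4π(g-1)+μ) > 2π`,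
then `V < 0`. -/
theorem stmt_9 (g : ℕ) (hg : 2 ≤ g) (L μ V : ℝ) (hL : 0 < L)
    (hL3 : L ^ 3 ≤ 2 * π ^ 2) (hμ : 0 ≤ μ) (hL2 : L ^ 2 ≤ π / ((g : ℝ) + 1))
    (h1 : V ≤ L * Real.sqrt (4 * π * ((g : ℝ) - 1) + μ) - μ / 4)
    (h2 : 2 * π < L * Real.sqrt (4 * π * ((g : ℝ) - 1) + μ)) :
    V < 0 := by
  have hg' : (2 : ℝ) ≤ g := by exact_mod_cast hg
  have hπ := Real.pi_pos
  have hx : Real.sqrt (4 * π * ((g : ℝ) - 1) + μ) ^ 2 = 4 * π * ((g : ℝ) - 1) + μ :=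
    Real.sq_sqrt (add_nonneg (mul_nonneg (by positivity) (by linarith)) hμ)
  set x := Real.sqrt (4 * π * ((g : ℝ) - 1) + μ)
  have hs : L ^ 2 * ((g : ℝ) + 1) ≤ π := (le_div_iff₀ (by linarith)).mp hL2
  have hsπ : L ^ 2 ≤ π := by nlinarith [sq_nonneg L]
  obtain ⟨t, ht⟩ : ∃ t, t = L * x - 2 * π := ⟨_, rfl⟩
  have ht0 : 0 < t := by linarith
  have hV : V ≤ L * x - x ^ 2 / 4 + π * ((g : ℝ) - 1) := by linarith
  have hLV : L ^ 2 * V ≤ L ^ 2 * (L * x - x ^ 2 / 4 + π * ((g : ℝ) - 1)) :=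
    mul_le_mul_of_nonneg_left hV (sq_nonneg L)
  have key : L ^ 2 * (L * x - x ^ 2 / 4 + π * ((g : ℝ) - 1)) =
      π * (L ^ 2 * ((g : ℝ) + 1) - π) + (L ^ 2 - π) * t - t ^ 2 / 4 := by
    rw [ht]; ring
  have hfirst : π * (L ^ 2 * ((g : ℝ) + 1) - π) ≤ 0 :=
    mul_nonpos_of_nonneg_of_nonpos hπ.le (by linarith)
  have hsecond : (L ^ 2 - π) * t ≤ 0 :=
    mul_nonpos_of_nonpos_of_nonneg (by linarith) ht0.le
  have ht2 : 0 < t ^ 2 := by positivity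
  have hneg : L ^ 2 * V < 0 := by linarith
  exact neg_of_mul_neg_right hneg (sq_nonneg L)
end

section
/- Let L, μ, V be real numbers with L > 0, L² ≤ 2/√3, and μ ≥ 0. If V ≤ L·√(4π + μ) − μ/4 and L·√(4π + μ) > 2π, then V < π·(3 − π/L²). -/
open Real

/-- for reals `L > 0` with `L² ≤ 2/√3` and `μ ≥ 0`, if
`V ≤ L*√(4π+μ) - μ/4` and `L*√(4π+μ) > 2π`, then `V < π*(3 - π/L²)`. -/
theorem stmt_10 (L μ V : ℝ) (hL : 0 < L) (hL2 : L ^ 2 ≤ 2 / Real.sqrt 3)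
    (hμ : 0 ≤ μ)
    (h1 : V ≤ L * Real.sqrt (4 * π + μ) - μ / 4)
    (h2 : 2 * π < L * Real.sqrt (4 * π + μ)) :
    V < π * (3 - π / L ^ 2) := by
  have hL2' : L ^ 2 ≤ 2 :=
    hL2.trans (div_le_self zero_le_two (Real.one_le_sqrt.2 (by norm_num)))
  have hx : Real.sqrt (4 * π + μ) ^ 2 = 4 * π + μ := Real.sq_sqrt (by positivity)
  set x := Real.sqrt (4 * π + μ)
  obtain ⟨y, hy⟩ : ∃ y, y = 2 * π / L := ⟨_, rfl⟩
  have hLy : L * y = 2 * π := by rw [hy]; field_simp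
  have hyx : y < x := lt_of_mul_lt_mul_left (hLy.trans_lt h2) hL.le
  have hy2 : 2 * L ≤ y := by
    rw [hy, le_div_iff₀ hL]
    nlinarith [Real.pi_gt_three]
  have hbound : π * (3 - π / L ^ 2) = L * y - y ^ 2 / 4 + π := by
    rw [hLy, hy]
    field_simp
    ring
  rw [hbound]
  nlinarith [mul_pos (sub_pos.2 hyx) (show 0 < x + y - 4 * L by linarith)]
end
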